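/- arXiv:2008.11272 — 6 statements merged into one kernel-verified Lean document; each statement's English description precedes it below -/
import Mathlib

section
/- Let R be a commutative ring, a, b ∈ R such that a - b is not a zero divisor, and set r = a + b and s = a·b. Let A be an n×n upper triangular matrix over R satisfying A·A - r•A + s•1 = 0, with every diagonal entry of A equal to a or to b. Then for every index i < n-1, if A i i = A (i+1) (i+1), then the superdiagonal entry A i (i+1) equals 0. -/
theorem superdiagonal_zero_of_equal_diag {R : Type*} [CommRing R] (a b : R)
    (hab : ∀ x : R, (a - b) * x = 0 → x = 0) {n : ℕ}
    (A : Matrix (Fin n) (Fin n) R)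
    (hupper : ∀ i j : Fin n, j < i → A i j = 0)
    (hdiag : ∀ i : Fin n, A i i = a ∨ A i i = b)
    (heq : A * A - (a + b) • A + (a * b) • (1 : Matrix (Fin n) (Fin n) R) = 0) :
    ∀ (i : ℕ) (hi : i + 1 < n),
      A ⟨i, Nat.lt_of_succ_lt hi⟩ ⟨i, Nat.lt_of_succ_lt hi⟩ = A ⟨i + 1, hi⟩ ⟨i + 1, hi⟩ →
      A ⟨i, Nat.lt_of_succ_lt hi⟩ ⟨i + 1, hi⟩ = 0 := by
  intro i hi hd
  set p : Fin n := ⟨i, Nat.lt_of_succ_lt hi⟩ with hp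
  set q : Fin n := ⟨i + 1, hi⟩ with hq
  have hpq : p ≠ q := by simp [hp, hq]
  have hmul : (A * A) p q = A p p * A p q + A p q * A q q := by
    rw [Matrix.mul_apply]
    refine Fintype.sum_eq_add p q hpq fun k hk => ?_
    rcases lt_or_gt_of_ne hk.1 with h | h
    · rw [hupper p k h, zero_mul]
    · have hqk : q < k := lt_of_le_of_ne (Nat.succ_le_of_lt h) hk.2.symm
      rw [hupper k q hqk, mul_zero]
  have hentry := congrFun (congrFun heq p) q
  simp only [Matrix.add_apply, Matrix.sub_apply, Matrix.smul_apply, Matrix.zero_apply,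
    Matrix.one_apply_ne hpq, smul_eq_mul, mul_zero, add_zero, hmul, ← hd] at hentry
  apply hab
  rcases hdiag p with h | h <;> rw [h] at hentry
  · linear_combination hentry
  · linear_combination -hentry
end

section
/- Let R be a commutative ring, a, b ∈ R such that a - b is not a zero divisor, and set r = a + b and s = a·b. Let A be an n×n upper triangular matrix over R whose every diagonal entry equals a or b. Then A·A - r•A + s•1 = 0 if and only if for all indices i < j with A i i = A j j one has (2·(A i i) - r)·(A i j) + ∑_{p, i < p < j} (A i p)·(A p j) = 0. (Entries A i j with i < j and A i i ≠ A j j are unconstrained.) -/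
/-- Entries of the product of two upper triangular matrices are supported on the interval
between the indices. -/
theorem Matrix.mul_apply_eq_sum_Icc_of_upper {R ι : Type*} [NonUnitalNonAssocSemiring R]
    [Fintype ι] [LinearOrder ι] [LocallyFiniteOrder ι] {A B : Matrix ι ι R}
    (hA : ∀ i j, j < i → A i j = 0) (hB : ∀ i j, j < i → B i j = 0) (i j : ι) :
    (A * B) i j = ∑ p ∈ Finset.Icc i j, A i p * B p j := by
  rw [Matrix.mul_apply]
  refine (Finset.sum_subset (Finset.subset_univ _) fun p _ hp => ?_).symm
  rw [Finset.mem_Icc, not_and_or, not_le, not_le] at hp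
  rcases hp with hp | hp
  · rw [hA i p hp, zero_mul]
  · rw [hB p j hp, mul_zero]

/-- Strictly above the diagonal, the two extreme terms of the product of two upper triangular
matrices involve the diagonal entries. -/
theorem Matrix.mul_apply_of_upper_of_lt {R ι : Type*} [NonUnitalNonAssocSemiring R]
    [Fintype ι] [LinearOrder ι] [LocallyFiniteOrder ι] {A B : Matrix ι ι R}
    (hA : ∀ i j, j < i → A i j = 0) (hB : ∀ i j, j < i → B i j = 0) {i j : ι} (hij : i < j) :
    (A * B) i j = A i i * B i j + (A i j * B j j + ∑ p ∈ Finset.Ioo i j, A i p * B p j) := by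
  rw [Matrix.mul_apply_eq_sum_Icc_of_upper hA hB, ← Finset.Ioc_insert_left hij.le,
    Finset.sum_insert Finset.left_notMem_Ioc, ← Finset.Ioo_insert_right hij,
    Finset.sum_insert Finset.right_notMem_Ioo]

/-- A matrix `Q` commuting with an upper triangular matrix `A` vanishes as soon as it vanishes
below the diagonal and at every position `(i, j)` for which `A i i - A j j` is a zero divisor. -/
theorem Matrix.eq_zero_of_commute_of_upper {R : Type*} [CommRing R] {n : ℕ}
    {A Q : Matrix (Fin n) (Fin n) R} (hA : ∀ i j, j < i → A i j = 0)
    (hQ : ∀ i j, j < i → Q i j = 0) (hcomm : A * Q = Q * A)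
    (h : ∀ i j, i ≤ j → Q i j = 0 ∨ ∀ x : R, (A i i - A j j) * x = 0 → x = 0) : Q = 0 := by
  have key : ∀ (d : ℕ) (i j : Fin n), (j : ℕ) < i + d → Q i j = 0 := by
    intro d
    induction d with
    | zero => exact fun i j hij => hQ i j hij
    | succ d ih =>
      intro i j hij
      rcases lt_or_ge j i with hlt | hle
      · exact hQ i j hlt
      rcases h i j hle with h0 | hreg
      · exact h0
      apply hreg
      have hAQ : (A * Q) i j = A i i * Q i j := by
        rw [Matrix.mul_apply]
        refine Finset.sum_eq_single i (fun p _ hp => ?_) (by simp)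
        rcases lt_or_gt_of_ne hp with hp | hp
        · rw [hA i p hp, zero_mul]
        · rw [ih p j (by omega), mul_zero]
      have hQA : (Q * A) i j = Q i j * A j j := by
        rw [Matrix.mul_apply]
        refine Finset.sum_eq_single j (fun p _ hp => ?_) (by simp)
        rcases lt_or_gt_of_ne hp with hp | hp
        · rw [ih i p (by omega), zero_mul]
        · rw [hA p j hp, mul_zero]
      rw [hcomm, hQA] at hAQ
      linear_combination -hAQ
  ext i j
  exact key n i j (by omega)

theorem quadratic_iff_recurrence {R : Type*} [CommRing R] (a b : R)
    (hab : ∀ x : R, (a - b) * x = 0 → x = 0) {n : ℕ}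
    (A : Matrix (Fin n) (Fin n) R)
    (hupper : ∀ i j : Fin n, j < i → A i j = 0)
    (hdiag : ∀ i : Fin n, A i i = a ∨ A i i = b) :
    A * A - (a + b) • A + (a * b) • (1 : Matrix (Fin n) (Fin n) R) = 0 ↔
      ∀ i j : Fin n, i < j → A i i = A j j →
        (2 * A i i - (a + b)) * A i j + ∑ p ∈ Finset.Ioo i j, A i p * A p j = 0 := by
  set Q := A * A - (a + b) • A + (a * b) • (1 : Matrix (Fin n) (Fin n) R) with hQdef
  have hQ_apply : ∀ i j, Q i j =
      (A * A) i j - (a + b) * A i j + a * b * (1 : Matrix (Fin n) (Fin n) R) i j :=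
    fun i j => by simp [hQdef]
  have hQ_above : ∀ i j, i < j → A i i = A j j → Q i j =
      (2 * A i i - (a + b)) * A i j + ∑ p ∈ Finset.Ioo i j, A i p * A p j := by
    intro i j hij hd
    rw [hQ_apply, Matrix.mul_apply_of_upper_of_lt hupper hupper hij, Matrix.one_apply_ne hij.ne,
      ← hd]
    ring
  constructor
  · intro h i j hij hd
    rw [← hQ_above i j hij hd, h, Matrix.zero_apply]
  · intro h
    refine Matrix.eq_zero_of_commute_of_upper hupper (fun i j hij => ?_) ?_ (fun i j hij => ?_)
    · rw [hQ_apply, Matrix.mul_apply_eq_sum_Icc_of_upper hupper hupper,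
        Finset.Icc_eq_empty hij.not_ge, Finset.sum_empty, hupper i j hij,
        Matrix.one_apply_ne hij.ne']
      ring
    · simp [hQdef, mul_add, add_mul, mul_sub, sub_mul, mul_assoc]
    · by_cases hd : A i i = A j j
      · left
        rcases hij.eq_or_lt with rfl | hlt
        · rw [hQ_apply, Matrix.mul_apply_eq_sum_Icc_of_upper hupper hupper, Finset.Icc_self,
            Finset.sum_singleton, Matrix.one_apply_eq]
          rcases hdiag i with hi | hi <;> rw [hi] <;> ring
        · rw [hQ_above i j hlt hd, h i j hlt hd]
      · right
        intro x hx
        apply hab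
        rcases hdiag i with hi | hi <;> rcases hdiag j with hj | hj <;> rw [hi, hj] at hx hd
        · exact absurd rfl hd
        · exact hx
        · linear_combination -hx
        · exact absurd rfl hd
end

section
/- Let R be a commutative ring, a, b ∈ R with a - b invertible (with inverse u = (a-b)⁻¹), and set r = a + b and s = a·b. Let A be an n×n upper triangular matrix over R whose every diagonal entry equals a or b. Then A·A - r•A + s•1 = 0 if and only if for all indices i < j with A i i = A j j one has: A i j = -u · ∑_{p, i < p < j} (A i p)·(A p j) if A i i = a, and A i j = u · ∑_{p, i < p < j} (A i p)·(A p j) if A i i = b. In particular, in either case A i (i+1) = 0 whenever A i i = A (i+1) (i+1). -/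
namespace Matrix

variable {ι R : Type*} [Fintype ι] [LinearOrder ι] [LocallyFiniteOrder ι] [CommRing R]

/-- Each entry of a product of upper triangular matrices is a sum over an interval. -/
theorem mul_apply_eq_sum_Icc_of_upper_s7 {M N : Matrix ι ι R}
    (hM : ∀ i j, j < i → M i j = 0) (hN : ∀ i j, j < i → N i j = 0) (i j : ι) :
    (M * N) i j = ∑ p ∈ Finset.Icc i j, M i p * N p j := by
  rw [mul_apply]
  refine (Finset.sum_subset (Finset.subset_univ _) fun p _ hp => ?_).symm
  rw [Finset.mem_Icc, not_and_or, not_le, not_le] at hp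
  rcases hp with hp | hp
  · rw [hM i p hp, zero_mul]
  · rw [hN p j hp, mul_zero]

theorem mul_apply_of_upper_of_lt_s7 {M N : Matrix ι ι R}
    (hM : ∀ i j, j < i → M i j = 0) (hN : ∀ i j, j < i → N i j = 0) {i j : ι} (hij : i < j) :
    (M * N) i j = M i i * N i j + M i j * N j j + ∑ p ∈ Finset.Ioo i j, M i p * N p j := by
  rw [mul_apply_eq_sum_Icc_of_upper_s7 hM hN, ← Finset.Ico_insert_right hij.le,
    Finset.sum_insert (by simp), ← Finset.Ioo_insert_left hij, Finset.sum_insert (by simp)]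
  ring

theorem mul_apply_self_of_upper {M N : Matrix ι ι R}
    (hM : ∀ i j, j < i → M i j = 0) (hN : ∀ i j, j < i → N i j = 0) (i : ι) :
    (M * N) i i = M i i * N i i := by
  rw [mul_apply_eq_sum_Icc_of_upper_s7 hM hN, Finset.Icc_self, Finset.sum_singleton]

theorem mul_apply_of_upper_of_gt {M N : Matrix ι ι R}
    (hM : ∀ i j, j < i → M i j = 0) (hN : ∀ i j, j < i → N i j = 0) {i j : ι} (hij : j < i) :
    (M * N) i j = 0 := by
  rw [mul_apply_eq_sum_Icc_of_upper_s7 hM hN, Finset.Icc_eq_empty_of_lt hij, Finset.sum_empty]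

/-- A strictly upper triangular matrix commuting with an upper triangular matrix `A` vanishes if
it vanishes at every `(i, j)` for which `A i i - A j j` is not regular. -/
theorem eq_zero_of_commute_upper {n : ℕ} {A E : Matrix (Fin n) (Fin n) R}
    (hA : ∀ i j, j < i → A i j = 0) (hE : ∀ i j, j ≤ i → E i j = 0) (hcomm : Commute A E)
    (h : ∀ i j, i < j → E i j = 0 ∨ IsRegular (A i i - A j j)) : E = 0 := by
  have key : ∀ (d : ℕ) (i j : Fin n), (j : ℕ) - i = d → E i j = 0 := by
    intro d
    induction d using Nat.strong_induction_on with
    | _ d ih =>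
      intro i j hd
      rcases le_or_gt j i with hji | hij
      · exact hE i j hji
      rcases h i j hij with h0 | hreg
      · exact h0
      have hE' : ∀ i j, j < i → E i j = 0 := fun i j hlt => hE i j hlt.le
      have hprod := congrFun (congrFun hcomm.eq i) j
      rw [mul_apply_of_upper_of_lt_s7 hA hE' hij, mul_apply_of_upper_of_lt_s7 hE' hA hij,
        hE i i le_rfl, hE j j le_rfl,
        Finset.sum_eq_zero fun p hp => ?_, Finset.sum_eq_zero fun p hp => ?_] at hprod
      · refine hreg.left ?_
        linear_combination hprod
      · rw [Finset.mem_Ioo] at hp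
        rw [ih ((p : ℕ) - i) (by have := hp.1; have := hp.2; omega) i p rfl, zero_mul]
      · rw [Finset.mem_Ioo] at hp
        rw [ih ((j : ℕ) - p) (by have := hp.1; have := hp.2; omega) p j rfl, mul_zero]
  ext i j
  exact key _ i j rfl

end Matrix

/-- The entries above the diagonal of the quadratic expression in an upper triangular matrix. -/
theorem quadratic_apply_of_lt {ι R : Type*} [Fintype ι] [LinearOrder ι] [LocallyFiniteOrder ι]
    [CommRing R] {A : Matrix ι ι R} (hA : ∀ i j, j < i → A i j = 0) (r s : R) {i j : ι}
    (hij : i < j) :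
    (A * A - r • A + s • (1 : Matrix ι ι R)) i j =
      (A i i + A j j - r) * A i j + ∑ p ∈ Finset.Ioo i j, A i p * A p j := by
  simp only [Matrix.add_apply, Matrix.sub_apply, Matrix.smul_apply, smul_eq_mul,
    Matrix.one_apply_ne hij.ne, Matrix.mul_apply_of_upper_of_lt_s7 hA hA hij]
  ring

theorem quadratic_iff_entry_formula {R : Type*} [CommRing R] (a b u : R)
    (hu : (a - b) * u = 1) {n : ℕ}
    (A : Matrix (Fin n) (Fin n) R)
    (hupper : ∀ i j : Fin n, j < i → A i j = 0)
    (hdiag : ∀ i : Fin n, A i i = a ∨ A i i = b) :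
    (A * A - (a + b) • A + (a * b) • (1 : Matrix (Fin n) (Fin n) R) = 0 ↔
      ∀ i j : Fin n, i < j → A i i = A j j →
        (A i i = a → A i j = -u * ∑ p ∈ Finset.Ioo i j, A i p * A p j) ∧
        (A i i = b → A i j = u * ∑ p ∈ Finset.Ioo i j, A i p * A p j)) ∧
    (A * A - (a + b) • A + (a * b) • (1 : Matrix (Fin n) (Fin n) R) = 0 →
      ∀ (i : ℕ) (hi : i + 1 < n),
        A ⟨i, Nat.lt_of_succ_lt hi⟩ ⟨i, Nat.lt_of_succ_lt hi⟩ = A ⟨i + 1, hi⟩ ⟨i + 1, hi⟩ →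
        A ⟨i, Nat.lt_of_succ_lt hi⟩ ⟨i + 1, hi⟩ = 0) := by
  have hiff : A * A - (a + b) • A + (a * b) • (1 : Matrix (Fin n) (Fin n) R) = 0 ↔
      ∀ i j : Fin n, i < j → A i i = A j j →
        (A i i = a → A i j = -u * ∑ p ∈ Finset.Ioo i j, A i p * A p j) ∧
        (A i i = b → A i j = u * ∑ p ∈ Finset.Ioo i j, A i p * A p j) := by
    constructor
    · intro h i j hij hd
      have hentry := quadratic_apply_of_lt hupper (a + b) (a * b) hij
      rw [h, Matrix.zero_apply, ← hd] at hentry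
      constructor <;> intro hi <;> rw [hi] at hentry
      · linear_combination -(A i j) * hu - u * hentry
      · linear_combination -(A i j) * hu + u * hentry
    · intro h
      have hreg : IsRegular (a - b) := (IsUnit.of_mul_eq_one u hu).isRegular
      have hreg' : IsRegular (b - a) :=
        (IsUnit.of_mul_eq_one (-u) (by linear_combination hu)).isRegular
      refine Matrix.eq_zero_of_commute_upper hupper (fun i j hji => ?_) ?_ fun i j hij => ?_
      · rcases hji.eq_or_lt with rfl | hlt
        · simp only [Matrix.add_apply, Matrix.sub_apply, Matrix.smul_apply, smul_eq_mul,
            Matrix.one_apply_eq, Matrix.mul_apply_self_of_upper hupper hupper]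
          rcases hdiag j with hj | hj <;> rw [hj] <;> ring
        · simp [Matrix.mul_apply_of_upper_of_gt hupper hupper hlt, hupper i j hlt,
            Matrix.one_apply_ne hlt.ne']
      · exact (((Commute.refl A).mul_right (Commute.refl A)).sub_right
          ((Commute.refl A).smul_right _)).add_right ((Commute.one_right A).smul_right _)
      · rw [quadratic_apply_of_lt hupper _ _ hij]
        have hform := h i j hij
        rcases hdiag i with hi | hi <;> rcases hdiag j with hj | hj
        · left
          have hA := (hform (hi.trans hj.symm)).1 hi
          rw [hi, hj]
          linear_combination (a - b) * hA - (∑ p ∈ Finset.Ioo i j, A i p * A p j) * hu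
        · right
          rwa [hi, hj]
        · right
          rwa [hi, hj]
        · left
          have hA := (hform (hi.trans hj.symm)).2 hi
          rw [hi, hj]
          linear_combination (b - a) * hA - (∑ p ∈ Finset.Ioo i j, A i p * A p j) * hu
  refine ⟨hiff, fun h i hi hd => ?_⟩
  have hij : (⟨i, Nat.lt_of_succ_lt hi⟩ : Fin n) < ⟨i + 1, hi⟩ := Nat.lt_succ_self i
  have hempty : Finset.Ioo (⟨i, Nat.lt_of_succ_lt hi⟩ : Fin n) ⟨i + 1, hi⟩ = ∅ := by
    ext p
    simp only [Finset.mem_Ioo, Fin.lt_def, Finset.notMem_empty, iff_false]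
    omega
  have hform := hiff.1 h _ _ hij hd
  rw [hempty, Finset.sum_empty, mul_zero, mul_zero] at hform
  exact (hdiag _).elim hform.1 hform.2
end

section
/- Let R be a commutative ring, a, b ∈ R such that a - b is not a zero divisor, and set r = a + b and s = a·b. Let A : ℕ → ℕ → R be an infinite upper triangular array (A i j = 0 whenever j < i) whose every diagonal entry A i i equals a or b. Then A satisfies the quadratic equation entrywise, i.e., for all i ≤ j: (∑_{p ∈ [i..j]} (A i p)·(A p j)) - r·(A i j) + (if i = j then s else 0) = 0, if and only if for all i < j with A i i = A j j one has (2·(A i i) - r)·(A i j) + ∑_{p, i < p < j} (A i p)·(A p j) = 0. -/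
/-- Associativity of the strictly upper triangular product of three infinite matrices. -/
theorem sum_Ioo_mul_sum_Ioo_comm {R : Type*} [CommRing R] (A B C : ℕ → ℕ → R) (i j : ℕ) :
    ∑ p ∈ Finset.Ioo i j, A i p * ∑ q ∈ Finset.Ioo p j, B p q * C q j =
      ∑ q ∈ Finset.Ioo i j, (∑ p ∈ Finset.Ioo i q, A i p * B p q) * C q j := by
  simp only [Finset.mul_sum, Finset.sum_mul, mul_assoc]
  apply Finset.sum_comm'
  intro p q
  simp only [Finset.mem_Ioo]
  omega

/-- Splitting off both end points of a sum over a closed interval. -/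
theorem sum_Icc_eq_add_sum_Ioo_add {M : Type*} [AddCommMonoid M] (f : ℕ → M) {i j : ℕ}
    (h : i < j) :
    ∑ p ∈ Finset.Icc i j, f p = f i + ∑ p ∈ Finset.Ioo i j, f p + f j := by
  rw [← Finset.Ico_insert_right h.le, Finset.sum_insert Finset.right_notMem_Ico,
    ← Finset.Ioo_insert_left h, Finset.sum_insert Finset.left_notMem_Ioo, add_comm]

theorem infinite_triangular_quadratic_iff {R : Type*} [CommRing R] (a b : R)
    (hab : ∀ x : R, (a - b) * x = 0 → x = 0)
    (A : ℕ → ℕ → R)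
    (hupper : ∀ i j : ℕ, j < i → A i j = 0)
    (hdiag : ∀ i : ℕ, A i i = a ∨ A i i = b) :
    (∀ i j : ℕ, i ≤ j →
        (∑ p ∈ Finset.Icc i j, A i p * A p j) - (a + b) * A i j
          + (if i = j then a * b else 0) = 0) ↔
      ∀ i j : ℕ, i < j → A i i = A j j →
        (2 * A i i - (a + b)) * A i j + ∑ p ∈ Finset.Ioo i j, A i p * A p j = 0 := by
  constructor
  · intro h i j hij hd
    have h' := h i j hij.le
    rw [sum_Icc_eq_add_sum_Ioo_add _ hij, if_neg hij.ne, ← hd] at h'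
    linear_combination h'
  · intro h
    have key : ∀ n i j : ℕ, j - i = n → i < j →
        (A i i + A j j - (a + b)) * A i j + ∑ p ∈ Finset.Ioo i j, A i p * A p j = 0 := by
      intro n
      induction n using Nat.strong_induction_on with
      | _ n ih =>
        intro i j hn hij
        by_cases hd : A i i = A j j
        · linear_combination h i j hij hd - A i j * hd
        have hcomm : (A j j - A i i) * ∑ p ∈ Finset.Ioo i j, A i p * A p j = 0 := by
          have hzero : ∑ p ∈ Finset.Ioo i j,
              ((A j j - A i i) * (A i p * A p j)
                + A i p * ∑ q ∈ Finset.Ioo p j, A p q * A q j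
                - (∑ q ∈ Finset.Ioo i p, A i q * A q p) * A p j) = 0 := by
            refine Finset.sum_eq_zero fun p hp => ?_
            obtain ⟨hip, hpj⟩ := Finset.mem_Ioo.mp hp
            linear_combination A i p * ih (j - p) (by omega) p j rfl hpj
              - A p j * ih (p - i) (by omega) i p rfl hip
          rw [Finset.sum_sub_distrib, Finset.sum_add_distrib, ← Finset.mul_sum,
            sum_Ioo_mul_sum_Ioo_comm] at hzero
          linear_combination hzero
        rcases hdiag i with hi | hi <;> rcases hdiag j with hj | hj
        · exact absurd (hi.trans hj.symm) hd
        · rw [hi, hj] at hcomm ⊢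
          linear_combination
            hab (∑ p ∈ Finset.Ioo i j, A i p * A p j) (by linear_combination -hcomm)
        · rw [hi, hj] at hcomm ⊢
          linear_combination hab _ hcomm
        · exact absurd (hi.trans hj.symm) hd
    intro i j hij
    rcases hij.eq_or_lt with rfl | hlt
    · rw [Finset.Icc_self, Finset.sum_singleton, if_pos rfl]
      rcases hdiag i with hi | hi <;> rw [hi] <;> ring
    · rw [sum_Icc_eq_add_sum_Ioo_add _ hlt, if_neg hlt.ne]
      linear_combination key _ i j rfl hlt
end

section
/- Let R be a commutative ring and let A be an n×n upper triangular matrix over R whose every diagonal entry equals 0 or 1. Then A is idempotent (A·A = A) if and only if for all indices i < j with A i i = A j j one has A i j = (1 - 2·(A i i)) · ∑_{p, i < p < j} (A i p)·(A p j). In particular A i (i+1) = 0 whenever A i i = A (i+1) (i+1), and entries A i j with A i i ≠ A j j are unconstrained. -/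
/-- An off-diagonal entry of the square of an upper triangular matrix. -/
theorem Matrix.mul_self_apply_of_upperTriangular {R : Type*} [CommRing R] {n : ℕ}
    (A : Matrix (Fin n) (Fin n) R) (hupper : ∀ i j : Fin n, j < i → A i j = 0)
    {i j : Fin n} (hij : i < j) :
    (A * A) i j = (A i i + A j j) * A i j + ∑ p ∈ Finset.Ioo i j, A i p * A p j := by
  have hsum : (A * A) i j = ∑ p ∈ Finset.Icc i j, A i p * A p j := by
    rw [Matrix.mul_apply]
    refine (Finset.sum_subset (Finset.subset_univ _) fun p _ hp => ?_).symm
    rw [Finset.mem_Icc, not_and_or, not_le, not_le] at hp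
    rcases hp with hp | hp
    · rw [hupper i p hp, zero_mul]
    · rw [hupper p j hp, mul_zero]
  rw [hsum, ← Finset.Ioc_insert_left hij.le, Finset.sum_insert Finset.left_notMem_Ioc,
    ← Finset.Ioo_insert_right hij, Finset.sum_insert Finset.right_notMem_Ioo]
  ring

/-- An entry of the defect `A * A - A` vanishes as soon as its diagonal entries are distinct
elements of `{0, 1}` and the entries to its left and below it vanish. -/
theorem Matrix.mul_self_sub_self_apply_eq_zero_of_diag_ne {R : Type*} [CommRing R] {n : ℕ}
    (A : Matrix (Fin n) (Fin n) R) (hupper : ∀ i j : Fin n, j < i → A i j = 0)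
    (hdiag : ∀ i : Fin n, A i i = 0 ∨ A i i = 1) {i j : Fin n}
    (hleft : ∀ p < j, (A * A - A) i p = 0) (hbelow : ∀ p > i, (A * A - A) p j = 0)
    (hne : A i i ≠ A j j) : (A * A - A) i j = 0 := by
  have hcomm : (A * A - A) * A = A * (A * A - A) := by noncomm_ring
  have hentry := congrFun (congrFun hcomm i) j
  rw [Matrix.mul_apply, Matrix.mul_apply, Finset.sum_eq_single j, Finset.sum_eq_single i]
    at hentry
  · rcases hdiag i with hi | hi <;> rcases hdiag j with hj | hj
    · exact absurd (hi.trans hj.symm) hne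
    · simpa only [hi, hj, mul_one, zero_mul] using hentry
    · simpa only [hi, hj, mul_zero, one_mul] using hentry.symm
    · exact absurd (hi.trans hj.symm) hne
  · intro p _ hp
    rcases lt_or_gt_of_ne hp with h | h
    · rw [hupper i p h, zero_mul]
    · rw [hbelow p h, mul_zero]
  · simp
  · intro p _ hp
    rcases lt_or_gt_of_ne hp with h | h
    · rw [hleft p h, zero_mul]
    · rw [hupper p j h, mul_zero]
  · simp

/-- The criterion for a matrix entry between equal diagonal entries. -/
theorem eq_two_mul_add_iff_of_eq_zero_or_eq_one {R : Type*} [CommRing R] {a x s : R}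
    (ha : a = 0 ∨ a = 1) : (a + a) * x + s = x ↔ x = (1 - 2 * a) * s := by
  rcases ha with rfl | rfl
  · exact ⟨fun h => by linear_combination -h, fun h => by linear_combination -h⟩
  · exact ⟨fun h => by linear_combination h, fun h => by linear_combination h⟩

/-- An upper triangular matrix with diagonal entries in `{0, 1}` is idempotent as soon as its
square agrees with it at the entries between equal diagonal entries. -/
theorem Matrix.mul_self_eq_self_of_upperTriangular {R : Type*} [CommRing R] {n : ℕ}
    (A : Matrix (Fin n) (Fin n) R) (hupper : ∀ i j : Fin n, j < i → A i j = 0)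
    (hdiag : ∀ i : Fin n, A i i = 0 ∨ A i i = 1)
    (heq : ∀ i j : Fin n, i < j → A i i = A j j → (A * A) i j = A i j) : A * A = A := by
  have hlower : ∀ i j : Fin n, j < i → (A * A) i j = 0 := by
    intro i j hji
    rw [Matrix.mul_apply]
    refine Finset.sum_eq_zero fun p _ => ?_
    rcases lt_or_ge p i with h | h
    · rw [hupper i p h, zero_mul]
    · rw [hupper p j (hji.trans_le h), mul_zero]
  have hdiag_sq : ∀ i : Fin n, (A * A) i i = A i i := by
    intro i
    rw [Matrix.mul_apply, Finset.sum_eq_single i]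
    · rcases hdiag i with h | h <;> simp [h]
    · intro p _ hp
      rcases lt_or_gt_of_ne hp with h | h
      · rw [hupper i p h, zero_mul]
      · rw [hupper p i h, mul_zero]
    · simp
  have hdefect : ∀ d : ℕ, ∀ i j : Fin n, (j : ℕ) < i + d → (A * A - A) i j = 0 := by
    intro d
    induction d with
    | zero =>
      intro i j h
      have hji : j < i := by simpa using h
      rw [Matrix.sub_apply, hlower i j hji, hupper i j hji, sub_zero]
    | succ d ih =>
      intro i j h
      rcases lt_trichotomy i j with hij | rfl | hji
      · by_cases hd : A i i = A j j
        · rw [Matrix.sub_apply, heq i j hij hd, sub_self]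
        · refine A.mul_self_sub_self_apply_eq_zero_of_diag_ne hupper hdiag
            (fun p hp => ih i p ?_) (fun p hp => ih p j ?_) hd <;> omega
      · rw [Matrix.sub_apply, hdiag_sq, sub_self]
      · rw [Matrix.sub_apply, hlower i j hji, hupper i j hji, sub_zero]
  ext i j
  exact sub_eq_zero.mp (hdefect n i j (by omega))

theorem idempotent_triangular_iff {R : Type*} [CommRing R] {n : ℕ}
    (A : Matrix (Fin n) (Fin n) R)
    (hupper : ∀ i j : Fin n, j < i → A i j = 0)
    (hdiag : ∀ i : Fin n, A i i = 0 ∨ A i i = 1) :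
    (A * A = A ↔
      ∀ i j : Fin n, i < j → A i i = A j j →
        A i j = (1 - 2 * A i i) * ∑ p ∈ Finset.Ioo i j, A i p * A p j) ∧
    (A * A = A →
      ∀ (i : ℕ) (hi : i + 1 < n),
        A ⟨i, Nat.lt_of_succ_lt hi⟩ ⟨i, Nat.lt_of_succ_lt hi⟩ = A ⟨i + 1, hi⟩ ⟨i + 1, hi⟩ →
        A ⟨i, Nat.lt_of_succ_lt hi⟩ ⟨i + 1, hi⟩ = 0) := by
  have hentry : ∀ i j : Fin n, i < j → A i i = A j j →
      ((A * A) i j = A i j ↔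
        A i j = (1 - 2 * A i i) * ∑ p ∈ Finset.Ioo i j, A i p * A p j) := by
    intro i j hij hd
    rw [A.mul_self_apply_of_upperTriangular hupper hij, ← hd]
    exact eq_two_mul_add_iff_of_eq_zero_or_eq_one (hdiag i)
  refine ⟨⟨fun h i j hij hd => (hentry i j hij hd).mp (by rw [h]), fun h =>
    A.mul_self_eq_self_of_upperTriangular hupper hdiag fun i j hij hd =>
      (hentry i j hij hd).mpr (h i j hij hd)⟩, fun h i hi hd => ?_⟩
  have hempty : Finset.Ioo (⟨i, Nat.lt_of_succ_lt hi⟩ : Fin n) ⟨i + 1, hi⟩ = ∅ := by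
    ext p
    simp only [Finset.mem_Ioo, Fin.lt_def, Finset.notMem_empty, iff_false]
    omega
  have hsucc := (hentry ⟨i, Nat.lt_of_succ_lt hi⟩ ⟨i + 1, hi⟩
    (Fin.mk_lt_mk.mpr i.lt_succ_self) hd).mp (by rw [h])
  rwa [hempty, Finset.sum_empty, mul_zero] at hsucc
end

section
/- Let R be a commutative ring in which 2 is invertible (with inverse ⅟2), and let A be an n×n upper triangular matrix over R whose every diagonal entry equals 1 or -1. Then A is an involution (A·A = 1, the identity matrix) if and only if for all indices i < j with A i i = A j j one has A i j = -⅟2 · (A i i) · ∑_{p, i < p < j} (A i p)·(A p j). In particular A i (i+1) = 0 whenever A i i = A (i+1) (i+1), and entries A i j with A i i = -(A j j) are unconstrained. -/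
namespace Matrix

variable {R : Type*} [CommRing R] {ι : Type*} [Fintype ι] [LinearOrder ι] [LocallyFiniteOrder ι]

theorem BlockTriangular.mul_apply_eq_sum_Icc {M N : Matrix ι ι R} (hM : M.BlockTriangular id)
    (hN : N.BlockTriangular id) (i j : ι) :
    (M * N) i j = ∑ p ∈ Finset.Icc i j, M i p * N p j := by
  rw [Matrix.mul_apply]
  refine (Finset.sum_subset (Finset.subset_univ _) fun p _ hp => ?_).symm
  rw [Finset.mem_Icc, not_and_or, not_le, not_le] at hp
  rcases hp with h | h
  · rw [hM h, zero_mul]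
  · rw [hN h, mul_zero]

theorem BlockTriangular.mul_apply_self {M N : Matrix ι ι R} (hM : M.BlockTriangular id)
    (hN : N.BlockTriangular id) (i : ι) : (M * N) i i = M i i * N i i := by
  simp [hM.mul_apply_eq_sum_Icc hN]

theorem BlockTriangular.mul_apply_of_lt {M N : Matrix ι ι R} (hM : M.BlockTriangular id)
    (hN : N.BlockTriangular id) {i j : ι} (hij : i < j) :
    (M * N) i j = M i i * N i j + M i j * N j j + ∑ p ∈ Finset.Ioo i j, M i p * N p j := by
  rw [hM.mul_apply_eq_sum_Icc hN, ← Finset.Ioc_insert_left hij.le,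
    Finset.sum_insert Finset.left_notMem_Ioc, ← Finset.Ioo_insert_right hij,
    Finset.sum_insert Finset.right_notMem_Ioo, add_assoc]

/-- If the square of an upper triangular matrix agrees with the identity on the diagonal and
strictly between `i` and `j`, then commutation with the square constrains its `(i, j)` entry. -/
theorem BlockTriangular.sub_mul_sq_apply_eq_zero {A : Matrix ι ι R} (hA : A.BlockTriangular id)
    (hsq : ∀ i, (A * A) i i = 1) {i j : ι} (hij : i < j)
    (hleft : ∀ p ∈ Finset.Ioo i j, (A * A) i p = 0)
    (hright : ∀ p ∈ Finset.Ioo i j, (A * A) p j = 0) :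
    (A i i - A j j) * (A * A) i j = 0 := by
  have hAA : (A * A).BlockTriangular id := hA.mul hA
  have h := congrFun (congrFun (Matrix.mul_assoc A A A) i) j
  rw [hAA.mul_apply_of_lt hA hij, hA.mul_apply_of_lt hAA hij, hsq, hsq,
    Finset.sum_eq_zero fun p hp => by rw [hleft p hp, zero_mul],
    Finset.sum_eq_zero fun p hp => by rw [hright p hp, mul_zero]] at h
  linear_combination -h

end Matrix

open Matrix

theorem involution_triangular_iff {R : Type*} [CommRing R] [Invertible (2 : R)] {n : ℕ}
    (A : Matrix (Fin n) (Fin n) R)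
    (hupper : ∀ i j : Fin n, j < i → A i j = 0)
    (hdiag : ∀ i : Fin n, A i i = 1 ∨ A i i = -1) :
    (A * A = (1 : Matrix (Fin n) (Fin n) R) ↔
      ∀ i j : Fin n, i < j → A i i = A j j →
        A i j = -⅟(2 : R) * A i i * ∑ p ∈ Finset.Ioo i j, A i p * A p j) ∧
    (A * A = (1 : Matrix (Fin n) (Fin n) R) →
      ∀ (i : ℕ) (hi : i + 1 < n),
        A ⟨i, Nat.lt_of_succ_lt hi⟩ ⟨i, Nat.lt_of_succ_lt hi⟩ = A ⟨i + 1, hi⟩ ⟨i + 1, hi⟩ →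
        A ⟨i, Nat.lt_of_succ_lt hi⟩ ⟨i + 1, hi⟩ = 0) := by
  have hA : A.BlockTriangular id := fun i j h => hupper i j h
  have hone : ∀ i, A i i * A i i = 1 := fun i => by rcases hdiag i with h | h <;> simp [h]
  have hsq : ∀ i, (A * A) i i = 1 := fun i => by rw [hA.mul_apply_self hA, hone]
  have htwo : ⅟(2 : R) * 2 = 1 := invOf_mul_self 2
  have hentry : A * A = 1 → ∀ i j : Fin n, i < j → A i i = A j j →
      A i j = -⅟(2 : R) * A i i * ∑ p ∈ Finset.Ioo i j, A i p * A p j := by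
    intro h i j hij hd
    have h0 := hA.mul_apply_of_lt hA hij
    rw [h, one_apply_ne hij.ne, ← hd] at h0
    linear_combination (-⅟(2 : R) * A i i) * h0 - (A i i * A i i * A i j) * htwo
      - A i j * hone i
  refine ⟨⟨hentry, fun h => ?_⟩, fun h i hi hd => ?_⟩
  · have hoff : ∀ (d : ℕ) (i j : Fin n), i < j → (j : ℕ) - i = d → (A * A) i j = 0 := by
      intro d
      induction d using Nat.strong_induction_on with
      | _ d ih =>
        intro i j hij hd
        by_cases hdij : A i i = A j j
        · rw [hA.mul_apply_of_lt hA hij, ← hdij]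
          linear_combination (2 * A i i) * h i j hij hdij
            - (∑ p ∈ Finset.Ioo i j, A i p * A p j) * (A i i * A i i * htwo + hone i)
        · have hneg : A j j = -A i i := by
            rcases hdiag i with hi | hi <;> rcases hdiag j with hj | hj <;> simp_all
          have h0 := hA.sub_mul_sq_apply_eq_zero hsq hij
            (fun p hp => by
              rw [Finset.mem_Ioo] at hp
              exact ih (p - i) (by lia) i p hp.1 rfl)
            (fun p hp => by
              rw [Finset.mem_Ioo] at hp
              exact ih (j - p) (by lia) p j hp.2 rfl)
          rw [hneg] at h0
          linear_combination (⅟(2 : R) * A i i) * h0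
            - (A * A) i j * (A i i * A i i * htwo + hone i)
    ext i j
    rcases lt_trichotomy i j with hij | rfl | hij
    · rw [hoff _ i j hij rfl, one_apply_ne hij.ne]
    · rw [hsq, one_apply_eq]
    · rw [hA.mul hA hij, one_apply_ne hij.ne']
  · rw [hentry h _ _ (Fin.mk_lt_mk.2 i.lt_succ_self) hd, Finset.sum_eq_zero, mul_zero]
    intro p hp
    rw [Finset.mem_Ioo, Fin.lt_def, Fin.lt_def] at hp
    lia
end
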